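/- arXiv:2407.19341 — 2 statements merged into one kernel-verified Lean document; each statement's English description precedes it below -/
import Mathlib

section
/- Let ε, c > 0 be real constants and let G be a finite simple graph with m ≥ 2 edges such that t(G) ≤ c·m^(1.5−ε). Then λ₁² + λ₂² ≤ m + (3c·m^(1.5−ε))^(2/3). -/
/-- The adjacency matrix of a simple graph over `ℝ` is Hermitian (symmetric). -/
lemma adjMatrix_isHermitian {V : Type*} [Fintype V] (G : SimpleGraph V)
    [DecidableRel G.Adj] : (G.adjMatrix ℝ).IsHermitian := by
  rw [Matrix.IsHermitian, Matrix.conjTranspose_eq_transpose_of_trivial]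
  exact G.isSymm_adjMatrix


lemma tangent_cube {x y : ℝ} (hx : 0 ≤ x) (hy : 0 ≤ y) :
    y ^ 3 + 3 / 2 * y * (x ^ 2 - y ^ 2) ≤ x ^ 3 := by
  nlinarith [mul_nonneg (sq_nonneg (x - y)) hx, mul_nonneg (sq_nonneg (x - y)) hy]

lemma swap_cube {a r z w : ℝ} (ha : 0 ≤ a) (hr : 0 ≤ r) (hz : 0 ≤ z) (hw : 0 ≤ w)
    (hrz : r ≤ z) (hza : z ≤ a) (h : z ^ 2 + w ^ 2 = a ^ 2 + r ^ 2) :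
    z ^ 3 + w ^ 3 ≤ a ^ 3 + r ^ 3 := by
  have D1 : 0 ≤ a ^ 2 - z ^ 2 := by nlinarith
  have D2 : 0 ≤ z ^ 2 - r ^ 2 := by nlinarith
  rcases le_total w z with hwz | hwz
  · have h1 := tangent_cube ha hz
    have h2 := tangent_cube hr hw
    have h3 : r ^ 2 - w ^ 2 = -(a ^ 2 - z ^ 2) := by linarith
    rw [h3] at h2
    nlinarith [mul_le_mul_of_nonneg_right hwz D1]
  · have h1 := tangent_cube ha hw
    have h2 := tangent_cube hr hz
    have h3 : a ^ 2 - w ^ 2 = z ^ 2 - r ^ 2 := by linarith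
    rw [h3] at h1
    nlinarith [mul_le_mul_of_nonneg_right hwz D2]

lemma sum_cube_le {ι : Type*} (T : Finset ι) (z : ι → ℝ) (M : ℝ) (h : ∀ i ∈ T, |z i| ≤ M) :
    ∑ i ∈ T, |z i| ^ 3 ≤ M * ∑ i ∈ T, z i ^ 2 := by
  rw [Finset.mul_sum]
  refine Finset.sum_le_sum fun i hi => ?_
  rw [← sq_abs (z i), pow_succ' _ 2]
  exact mul_le_mul_of_nonneg_right (h i hi) (by positivity)

lemma sum_cube_le' {ι : Type*} (T : Finset ι) (z : ι → ℝ) (M : ℝ) (hM : 0 ≤ M)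
    (h : ∑ i ∈ T, z i ^ 2 = M ^ 2) : ∑ i ∈ T, |z i| ^ 3 ≤ M ^ 3 := by
  refine (sum_cube_le T z M fun i hi => ?_).trans (by rw [h]; exact le_of_eq (by ring))
  refine abs_le_of_sq_le_sq ?_ hM
  rw [← h]
  exact Finset.single_le_sum (f := fun i => z i ^ 2) (fun i _ => sq_nonneg _) hi

lemma coreA {ι : Type*} [DecidableEq ι] (T : Finset ι) (z : ι → ℝ) (α β d s : ℝ)
    (hβ : 0 ≤ β) (hαβ : β ≤ α) (hd : 0 ≤ d) (hz : ∀ i ∈ T, |z i| ≤ α)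
    (h2 : ∑ i ∈ T, z i ^ 2 = α ^ 2 + β ^ 2 - 2 * d ^ 2)
    (h3 : α ^ 3 + β ^ 3 + ∑ i ∈ T, z i ^ 3 ≤ 2 * s) : d ^ 3 ≤ s := by
  have hα := hβ.trans hαβ
  have habs : - ∑ i ∈ T, |z i| ^ 3 ≤ ∑ i ∈ T, z i ^ 3 := by
    rw [← Finset.sum_neg_distrib]
    refine Finset.sum_le_sum fun i _ => ?_
    rw [← abs_pow]; exact neg_abs_le _
  have superadd : ∀ {x y w : ℝ}, 0 ≤ x → 0 ≤ y → 0 ≤ w → w ^ 2 = x ^ 2 + y ^ 2 →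
      x ^ 3 + y ^ 3 ≤ w ^ 3 := by
    intro x y w hx hy hw h
    have hxw : x ≤ w := abs_le_of_sq_le_sq' (by nlinarith) hw |>.2
    have hyw : y ≤ w := abs_le_of_sq_le_sq' (by nlinarith) hw |>.2
    nlinarith [mul_le_mul_of_nonneg_right hxw (sq_nonneg x), mul_le_mul_of_nonneg_right hyw (sq_nonneg y)]
  have hR : 0 ≤ ∑ i ∈ T, z i ^ 2 := Finset.sum_nonneg fun i _ => sq_nonneg _
  rcases le_total (β ^ 2) (2 * d ^ 2) with hb | hb
  · have hρ := Real.sq_sqrt hR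
    set ρ := √(∑ i ∈ T, z i ^ 2)
    have hρ0 : 0 ≤ ρ := Real.sqrt_nonneg _
    have hg := Real.sq_sqrt (sub_nonneg.2 hb)
    set g := √(2 * d ^ 2 - β ^ 2)
    have hg0 : 0 ≤ g := Real.sqrt_nonneg _
    have k1 := sum_cube_le' T z ρ hρ0 hρ.symm
    have k2 := superadd hρ0 hg0 hα (by linarith)
    have k3 := tangent_cube hg0 hd
    have k4 := tangent_cube hβ hd
    have : 3 / 2 * d * (g ^ 2 - d ^ 2) + 3 / 2 * d * (β ^ 2 - d ^ 2) = 0 := by rw [hg]; ring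
    linarith
  · have hρ := Real.sq_sqrt (sub_nonneg.2 hb)
    set ρ := √(β ^ 2 - 2 * d ^ 2)
    have hρ0 : 0 ≤ ρ := Real.sqrt_nonneg _
    have hg := Real.sq_sqrt (show 0 ≤ 2 * d ^ 2 by positivity)
    set g := √(2 * d ^ 2)
    have hg0 : 0 ≤ g := Real.sqrt_nonneg _
    have hρα : ρ ≤ α := abs_le_of_sq_le_sq' (by nlinarith) hα |>.2
    have k1 := superadd hρ0 hg0 hβ (by linarith)
    have k2 := tangent_cube hg0 hd
    rw [hg] at k2
    have hd3 : 0 ≤ d ^ 3 := by positivity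
    have k3 : ∑ i ∈ T, |z i| ^ 3 ≤ α ^ 3 + ρ ^ 3 := by
      by_cases hall : ∀ i ∈ T, |z i| ≤ ρ
      · have := sum_cube_le T z ρ hall
        rw [h2] at this
        nlinarith [mul_le_mul_of_nonneg_right hρα (sq_nonneg α)]
      · push Not at hall
        obtain ⟨j, hj, hjρ⟩ := hall
        have e2 := Finset.add_sum_erase T (fun i => z i ^ 2) hj
        have e3 := Finset.add_sum_erase T (fun i => |z i| ^ 3) hj
        have hW : 0 ≤ ∑ i ∈ T.erase j, z i ^ 2 := Finset.sum_nonneg fun i _ => sq_nonneg _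
        have hw := Real.sq_sqrt hW
        set w := √(∑ i ∈ T.erase j, z i ^ 2)
        have hw0 : 0 ≤ w := Real.sqrt_nonneg _
        have l1 := sum_cube_le' _ z w hw0 hw.symm
        have l2 := swap_cube hα hρ0 (abs_nonneg (z j)) hw0 hjρ.le (hz j hj)
          (by rw [sq_abs]; linarith)
        linarith
    nlinarith

lemma coreB {ι : Type*} (T : Finset ι) (hT : T.Nonempty) (z : ι → ℝ) (α q d s : ℝ)
    (hq : 0 < q) (hd : 0 ≤ d) (hz : ∀ i ∈ T, z i ≤ -q)
    (h1 : α - q + ∑ i ∈ T, z i = 0)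
    (h2 : ∑ i ∈ T, z i ^ 2 = α ^ 2 + q ^ 2 - 2 * d ^ 2)
    (h3 : α ^ 3 - q ^ 3 + ∑ i ∈ T, z i ^ 3 ≤ 2 * s) : d ^ 3 ≤ s := by
  have hle : ∀ i ∈ T, -z i ≤ α - q := by
    intro i hi
    have := Finset.single_le_sum (f := fun i => - z i)
      (fun i hi => by have := hz i hi; linarith) hi
    simp only [Finset.sum_neg_distrib] at this
    linarith
  obtain ⟨j, hj⟩ := hT
  have hα : 2 * q ≤ α := by have := hle j hj; have := hz j hj; linarith
  have hS : q ^ 2 ≤ ∑ i ∈ T, z i ^ 2 := by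
    have := Finset.single_le_sum (f := fun i => z i ^ 2) (fun i _ => sq_nonneg _) hj
    have := hz j hj
    nlinarith
  have c3 : - ∑ i ∈ T, z i ^ 3 ≤ (α - q) * ∑ i ∈ T, z i ^ 2 := by
    rw [Finset.mul_sum, ← Finset.sum_neg_distrib]
    refine Finset.sum_le_sum fun i hi => ?_
    nlinarith [mul_le_mul_of_nonneg_right (hle i hi) (sq_nonneg (z i))]
  have c2 : ∑ i ∈ T, z i ^ 2 ≤ (α - q) * (α - q) := by
    have : α - q = ∑ i ∈ T, - z i := by rw [Finset.sum_neg_distrib]; linarith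
    have h' : (α - q) * (α - q) = ∑ i ∈ T, (α - q) * (- z i) := by
      rw [← Finset.mul_sum, ← this]
    rw [h']
    refine Finset.sum_le_sum fun i hi => ?_
    have := hz i hi
    nlinarith [mul_le_mul_of_nonneg_right (hle i hi) (show 0 ≤ - z i by linarith)]
  obtain ⟨S, hSd⟩ : ∃ S, S = q ^ 2 + ∑ i ∈ T, z i ^ 2 := ⟨_, rfl⟩
  obtain ⟨e, he⟩ : ∃ e, e = (α ^ 2 - S) / 2 := ⟨_, rfl⟩
  have hd2 : d ^ 2 = e + q ^ 2 := by rw [he, hSd]; linarith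
  have he1 : q ^ 2 ≤ e := by nlinarith
  have hS2 : 2 * q ^ 2 ≤ S := by linarith
  have hL : α ^ 2 = 2 * e + S := by linarith
  have key : 2 * e * α + q * S ≤ 2 * s := by
    have : α ^ 3 = (2 * e + S) * α := by rw [← hL]; ring
    nlinarith
  have hα0 : 0 < α := by linarith
  have he0 : 0 < e := by nlinarith
  have hS0 : 0 ≤ S := by nlinarith
  have hfin : d ^ 3 ≤ (2 * e * α + q * S) / 2 := by
    refine abs_le_of_sq_le_sq' ?_ (by positivity) |>.2
    have : (d ^ 3) ^ 2 = (e + q ^ 2) ^ 3 := by rw [← hd2]; ring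
    rw [this]
    have x1 : e ^ 2 * (2 * e + 2 * q ^ 2) ≤ e ^ 2 * α ^ 2 := by
      rw [hL]; gcongr
    have x2 : e * (2 * q) * q * (2 * q ^ 2) ≤ e * α * q * S := by gcongr
    have x3 : q ^ 2 * (2 * q ^ 2) ^ 2 ≤ q ^ 2 * S ^ 2 := by gcongr
    have x4 : 0 ≤ e * (e * (e - q ^ 2)) := mul_nonneg he0.le (mul_nonneg he0.le (by linarith))
    have x5 : 0 ≤ e * q ^ 4 := by positivity
    nlinarith
  linarith

lemma adj_trace_pow {V : Type*} [Fintype V] [DecidableEq V] {A : Matrix V V ℝ}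
    (hA : A.IsHermitian) (k : ℕ) :
    (A ^ k).trace = ∑ v, hA.eigenvalues v ^ k := by
  conv_lhs => rw [hA.spectral_theorem]
  rw [← map_pow, Unitary.conjStarAlgAut_apply, Matrix.trace_mul_cycle, Unitary.coe_star_mul_self,
    one_mul, Matrix.diagonal_pow, Matrix.trace_diagonal]
  simp

lemma adj_trace_sq {V : Type*} [Fintype V] [DecidableEq V]
    (G : SimpleGraph V) [DecidableRel G.Adj] :
    ((G.adjMatrix ℝ) ^ 2).trace = 2 * (G.edgeFinset.card : ℝ) := by
  rw [sq, Matrix.trace]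
  simp only [Matrix.diag_apply, SimpleGraph.adjMatrix_mul_self_apply_self]
  exact_mod_cast G.sum_degrees_eq_twice_card_edges

lemma adj_trace_cube {V : Type*} [Fintype V] [DecidableEq V]
    (G : SimpleGraph V) [DecidableRel G.Adj] :
    ((G.adjMatrix ℝ) ^ 3).trace ≤ 6 * ((G.cliqueFinset 3).card : ℝ) := by
  let F : Finset (V × V × V) :=
    Finset.univ.filter fun p => G.Adj p.1 p.2.1 ∧ G.Adj p.2.1 p.2.2 ∧ G.Adj p.2.2 p.1
  have h1 : ((G.adjMatrix ℝ) ^ 3).trace = (F.card : ℝ) := by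
    rw [pow_succ, sq, Matrix.trace]
    simp only [Matrix.diag_apply, Matrix.mul_apply, SimpleGraph.adjMatrix_apply, F,
      Finset.card_filter, Nat.cast_sum, Fintype.sum_prod_type, Finset.sum_mul]
    refine Finset.sum_congr rfl fun a _ => ?_
    rw [Finset.sum_comm]
    refine Finset.sum_congr rfl fun b _ => Finset.sum_congr rfl fun c _ => ?_
    by_cases h1 : G.Adj a b <;> by_cases h2 : G.Adj b c <;> by_cases h3 : G.Adj c a <;>
      simp [h1, h2, h3]
  have h2 : F.card ≤ 6 * (G.cliqueFinset 3).card := by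
    refine Finset.card_le_mul_card_image_of_maps_to
      (f := fun p : V × V × V => ({p.1, p.2.1, p.2.2} : Finset V)) ?_ 6 ?_
    · rintro ⟨a, b, c⟩ h
      simp only [F, Finset.mem_filter, Finset.mem_univ, true_and, Finset.coe_filter,
        Set.mem_setOf_eq] at h
      simp only [Finset.mem_coe, SimpleGraph.mem_cliqueFinset_iff, SimpleGraph.is3Clique_triple_iff]
      exact ⟨h.1, h.2.2.symm, h.2.1⟩
    · intro s hs
      rw [SimpleGraph.mem_cliqueFinset_iff, SimpleGraph.is3Clique_iff] at hs
      obtain ⟨x, y, z, hxy, hxz, hyz, rfl⟩ := hs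
      refine (Finset.card_le_card (t := {(x, y, z), (x, z, y), (y, x, z), (y, z, x), (z, x, y),
        (z, y, x)}) ?_).trans Finset.card_le_six
      rintro ⟨a, b, c⟩ h
      simp only [F, Finset.mem_filter, Finset.mem_univ, true_and] at h
      obtain ⟨⟨hab, hbc, hca⟩, he⟩ := h
      have ha : a ∈ ({x, y, z} : Finset V) := by rw [← he]; simp
      have hb : b ∈ ({x, y, z} : Finset V) := by rw [← he]; simp
      have hc : c ∈ ({x, y, z} : Finset V) := by rw [← he]; simp
      have n1 := hab.ne
      have n2 := hbc.ne
      have n3 := hca.ne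
      clear he
      simp only [Finset.mem_insert, Finset.mem_singleton] at ha hb hc
      rcases ha with rfl | rfl | rfl <;> rcases hb with rfl | rfl | rfl <;>
        rcases hc with rfl | rfl | rfl <;> simp_all
  rw [h1]
  exact_mod_cast h2

lemma adj_trace_pow_nonneg {V : Type*} [Fintype V] [DecidableEq V]
    (G : SimpleGraph V) [DecidableRel G.Adj] (k : ℕ) :
    0 ≤ ((G.adjMatrix ℝ) ^ k).trace := by
  refine Finset.sum_nonneg fun v _ => ?_
  rw [Matrix.diag_apply, SimpleGraph.adjMatrix_pow_apply_eq_card_walk]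
  positivity

lemma abs_le_of_odd_sums {ι : Type*} [Fintype ι] (x : ι → ℝ) (a : ℝ) (ha : ∀ i, x i ≤ a)
    (h : ∀ k : ℕ, 0 ≤ ∑ i, x i ^ (2 * k + 1)) (ha0 : 0 ≤ a) (i : ι) : |x i| ≤ a := by
  classical
  refine abs_le.2 ⟨?_, ha i⟩
  by_contra! hlt
  obtain ⟨y, hy⟩ : ∃ y, y = - x i := ⟨_, rfl⟩
  have hya : a < y := by linarith
  have hy0 : 0 < y := by linarith
  have hb : ∀ k : ℕ, y ^ (2 * k + 1) ≤ Fintype.card ι * a ^ (2 * k + 1) := by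
    intro k
    have h1 := Finset.add_sum_erase Finset.univ (fun i => x i ^ (2 * k + 1)) (Finset.mem_univ i)
    have h2 : ∑ j ∈ Finset.univ.erase i, x j ^ (2 * k + 1) ≤
        ∑ j ∈ Finset.univ.erase i, a ^ (2 * k + 1) :=
      Finset.sum_le_sum fun j _ => (Odd.strictMono_pow (odd_two_mul_add_one k)).monotone (ha j)
    have h3 : ∑ j ∈ Finset.univ.erase i, a ^ (2 * k + 1) ≤ Fintype.card ι * a ^ (2 * k + 1) := by
      rw [Finset.sum_const, nsmul_eq_mul]
      gcongr
      exact Finset.card_le_univ _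
    have h4 := h k
    have h5 : x i ^ (2 * k + 1) = - y ^ (2 * k + 1) := by
      rw [← Odd.neg_pow (odd_two_mul_add_one k), hy, neg_neg]
    linarith
  have hq0 : 0 ≤ a / y := by positivity
  have hq1 : a / y < 1 := (div_lt_one hy0).2 hya
  have hN : (0 : ℝ) < Fintype.card ι := by
    exact_mod_cast Fintype.card_pos_iff.2 ⟨i⟩
  obtain ⟨k, hk⟩ := exists_pow_lt_of_lt_one (inv_pos.2 hN) hq1
  have h6 : (a / y) ^ (2 * k + 1) ≤ (a / y) ^ k :=
    pow_le_pow_of_le_one hq0 hq1.le (by omega)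
  have h7 : (a / y) ^ (2 * k + 1) < (Fintype.card ι : ℝ)⁻¹ := h6.trans_lt hk
  rw [div_pow, div_lt_iff₀ (by positivity), inv_mul_eq_div, lt_div_iff₀ hN] at h7
  have := hb k
  linarith

/-- **Theorem.** Let `ε, c > 0` and let `G` have `m ≥ 2` edges and at most `c·m^(1.5−ε)`
triangles. Then `λ₁² + λ₂² ≤ m + (3c·m^(1.5−ε))^(2/3)`, where `λ₁ = μ 0` and `λ₂ = μ 1`
are the two largest eigenvalues of the adjacency matrix (`μ` lists the eigenvalues in
non-increasing order; note `m ≥ 2` forces the graph to have more than one vertex). -/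
theorem stmt_2 {V : Type*} [Fintype V] [DecidableEq V]
    (G : SimpleGraph V) [DecidableRel G.Adj]
    (ε c : ℝ) (hε : 0 < ε) (hc : 0 < c)
    (m : ℕ) (hm : G.edgeFinset.card = m) (hm2 : 2 ≤ m)
    (μ : Fin (Fintype.card V) → ℝ) (hanti : Antitone μ)
    (hμ : ∃ e : V ≃ Fin (Fintype.card V),
      ∀ v, (adjMatrix_isHermitian G).eigenvalues v = μ (e v))
    (ht : ((G.cliqueFinset 3).card : ℝ) ≤ c * (m : ℝ) ^ (1.5 - ε)) :
    ∀ h1 : 1 < Fintype.card V,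
      μ ⟨0, by omega⟩ ^ 2 + μ ⟨1, h1⟩ ^ 2
        ≤ (m : ℝ) + (3 * c * (m : ℝ) ^ (1.5 - ε)) ^ ((2 : ℝ) / 3) := by
  intro h1
  obtain ⟨e, he⟩ := hμ
  have tr : ∀ k : ℕ, ((G.adjMatrix ℝ) ^ k).trace = ∑ i, μ i ^ k := by
    intro k
    rw [adj_trace_pow (adjMatrix_isHermitian G), ← Equiv.sum_comp e]
    simp only [he]
  have t1 : ∑ i, μ i = 0 := by
    have := tr 1
    simp only [pow_one] at this
    rw [← this, SimpleGraph.trace_adjMatrix]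
  have t2 : ∑ i, μ i ^ 2 = 2 * (m : ℝ) := by rw [← tr, adj_trace_sq, hm]
  have t3 : ∑ i, μ i ^ 3 ≤ 2 * (3 * c * (m : ℝ) ^ (1.5 - ε)) := by
    rw [← tr]
    refine (adj_trace_cube G).trans ?_
    linarith
  have hs0 : 0 ≤ 3 * c * (m : ℝ) ^ (1.5 - ε) := by positivity
  generalize 3 * c * (m : ℝ) ^ (1.5 - ε) = s at *
  have hn3 : 2 < Fintype.card V := by
    by_contra hn
    have h2 : Fintype.card V = 2 := by omega
    have := G.card_edgeFinset_le_card_choose_two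
    rw [h2, hm] at this
    simp at this
    omega
  set i0 : Fin (Fintype.card V) := ⟨0, by omega⟩ with hi0
  set i1 : Fin (Fintype.card V) := ⟨1, h1⟩ with hi1
  have h01 : i1 ≠ i0 := by simp [hi0, hi1]
  let T : Finset (Fin (Fintype.card V)) := (Finset.univ.erase i0).erase i1
  have split : ∀ f : Fin (Fintype.card V) → ℝ, ∑ i, f i = f i0 + f i1 + ∑ i ∈ T, f i := by
    intro f
    rw [← Finset.add_sum_erase _ f (Finset.mem_univ i0),
      ← Finset.add_sum_erase _ f (Finset.mem_erase.2 ⟨h01, Finset.mem_univ i1⟩), add_assoc]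
  have le0 : ∀ i, μ i ≤ μ i0 := fun i => hanti (by simp [hi0, Fin.le_def])
  have le1 : ∀ i ∈ T, μ i ≤ μ i1 := by
    intro i hi
    apply hanti
    simp only [T, Finset.mem_erase, ne_eq, Finset.mem_univ, and_true] at hi
    have : i.val ≠ 0 := fun h => hi.2 (Fin.ext h)
    rw [Fin.le_def]
    show 1 ≤ i.val
    omega
  have hpos : 0 ≤ μ i0 := by
    by_contra! hneg
    have : ∑ i, μ i < 0 := Finset.sum_neg (fun i _ => (le0 i).trans_lt hneg) ⟨i0, Finset.mem_univ _⟩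
    linarith
  have habs : ∀ i, |μ i| ≤ μ i0 :=
    abs_le_of_odd_sums μ _ le0 (fun k => by rw [← tr]; exact adj_trace_pow_nonneg G _) hpos
  rcases le_or_gt (μ i0 ^ 2 + μ i1 ^ 2) m with hle | hgt
  · have := Real.rpow_nonneg hs0 ((2 : ℝ) / 3)
    linarith
  have hd := Real.sq_sqrt (sub_nonneg.2 hgt.le)
  set d := √(μ i0 ^ 2 + μ i1 ^ 2 - m)
  have hd0 : 0 ≤ d := Real.sqrt_nonneg _
  rw [split] at t1 t2 t3
  have key : d ^ 3 ≤ s := by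
    rcases le_or_gt 0 (μ i1) with h | h
    · exact coreA T μ (μ i0) (μ i1) d s h (le0 i1) hd0 (fun i _ => habs i) (by linarith) t3
    · refine coreB T ?_ μ (μ i0) (-μ i1) d s (by linarith) hd0 (fun i hi => by linarith [le1 i hi])
        (by linarith) (by rw [neg_sq]; linarith) (by rw [Odd.neg_pow (by decide)]; linarith)
      exact ⟨⟨2, hn3⟩, by simp [T, hi0, hi1]⟩
  have hfin : d ^ 2 ≤ s ^ ((2 : ℝ) / 3) := by
    have h5 := Real.rpow_le_rpow (by positivity) key (show (0 : ℝ) ≤ 2 / 3 by norm_num)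
    have h6 : (d ^ 3) ^ ((2 : ℝ) / 3) = d ^ 2 := by
      rw [← Real.rpow_natCast d 3, ← Real.rpow_mul hd0, ← Real.rpow_natCast d 2]
      norm_num
    rwa [h6] at h5
  linarith
end

section
/- Let k ≥ 2 be an integer and let G be a finite simple graph with m edges that is B_k-free, i.e., there is no pair of adjacent vertices u, v in G having at least k common neighbors. If m ≥ (10.06·(k−1)·√(k+1)/3)², then s_ℓ(G) ≤ 2m·(1 − 1/ω(G)), where ℓ = min{n⁺, ω(G)}. -/
open Matrix in
lemma aux_trace_pow {V : Type*} [Fintype V] [DecidableEq V] {A : Matrix V V ℝ}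
    (hA : A.IsHermitian) (p : ℕ) : (A ^ p).trace = ∑ i, hA.eigenvalues i ^ p := by
  conv_lhs => rw [hA.spectral_theorem, ← map_pow, Unitary.conjStarAlgAut_apply, trace_mul_cycle,
    Unitary.coe_star_mul_self, one_mul, diagonal_pow, trace_diagonal]
  simp

open Matrix in
lemma aux_rayleigh {V : Type*} [Fintype V] [DecidableEq V] {A : Matrix V V ℝ}
    (hA : A.IsHermitian) (a : ℝ) (ha : ∀ i, hA.eigenvalues i ≤ a) (x : V → ℝ) :
    x ⬝ᵥ (A *ᵥ x) ≤ a * (x ⬝ᵥ x) := by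
  have h1 : a • (1 : Matrix V V ℝ) - A = (hA.eigenvectorUnitary : Matrix V V ℝ) *
      diagonal (fun i => a - hA.eigenvalues i) * (hA.eigenvectorUnitary : Matrix V V ℝ)ᴴ := by
    have h2 : diagonal (fun i => a - hA.eigenvalues i) =
        a • (1 : Matrix V V ℝ) - diagonal ((RCLike.ofReal : ℝ → ℝ) ∘ hA.eigenvalues) := by
      ext i j
      by_cases h : i = j
      · subst h; simp
      · simp [h]
    have h3 := hA.spectral_theorem
    rw [Unitary.conjStarAlgAut_apply] at h3
    rw [h2, Matrix.mul_sub, Matrix.sub_mul, ← star_eq_conjTranspose]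
    conv_lhs => rw [h3]
    congr 1
    simp
  have h4 : (a • (1 : Matrix V V ℝ) - A).PosSemidef := by
    rw [h1]
    apply PosSemidef.mul_mul_conjTranspose_same
    rw [posSemidef_diagonal_iff]
    intro i
    linarith [ha i]
  have h5 := h4.dotProduct_mulVec_nonneg x
  simp [sub_mulVec, smul_mulVec] at h5
  linarith

open Matrix in
lemma aux_perron {V : Type*} [Fintype V] [DecidableEq V] {A : Matrix V V ℝ}
    (hA : A.IsHermitian) (hn : ∀ i j, 0 ≤ A i j) (a : ℝ) (ha : ∀ i, hA.eigenvalues i ≤ a) (i : V) :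
    |hA.eigenvalues i| ≤ a := by
  set x : V → ℝ := ⇑(hA.eigenvectorBasis i) with hx
  have hxx : x ⬝ᵥ x = 1 := by
    have h := hA.eigenvectorBasis.orthonormal.1 i
    have h2 : inner ℝ (hA.eigenvectorBasis i) (hA.eigenvectorBasis i) = (1:ℝ) := by
      rw [real_inner_self_eq_norm_sq, h]; norm_num
    rw [EuclideanSpace.inner_eq_star_dotProduct] at h2
    simpa using h2
  have h1 : x ⬝ᵥ (A *ᵥ x) = hA.eigenvalues i := by
    rw [hx, hA.mulVec_eigenvectorBasis, ← hx, dotProduct_smul, hxx]; simp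
  have h2 := aux_rayleigh hA a ha (fun v => |x v|)
  have h3 : (fun v => |x v|) ⬝ᵥ (fun v => |x v|) = 1 := by
    rw [← hxx]; simp [dotProduct]
  rw [h3, mul_one] at h2
  refine le_trans ?_ h2
  rw [← h1]
  simp only [dotProduct, mulVec]
  refine (Finset.abs_sum_le_sum_abs _ _).trans (Finset.sum_le_sum fun u _ => ?_)
  rw [abs_mul]
  refine mul_le_mul_of_nonneg_left ?_ (abs_nonneg _)
  refine (Finset.abs_sum_le_sum_abs _ _).trans (Finset.sum_le_sum fun v _ => ?_)
  rw [abs_mul, abs_of_nonneg (hn u v)]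

lemma aux_sq {V : Type*} [Fintype V] [DecidableEq V] (G : SimpleGraph V) [DecidableRel G.Adj] :
    (G.adjMatrix ℝ ^ 2).trace = 2 * (G.edgeFinset.card : ℝ) := by
  rw [pow_two, Matrix.trace]
  simp only [Matrix.diag, SimpleGraph.adjMatrix_mul_self_apply_self]
  exact_mod_cast G.sum_degrees_eq_twice_card_edges

lemma aux_cube {V : Type*} [Fintype V] [DecidableEq V] (G : SimpleGraph V) [DecidableRel G.Adj]
    (c : ℝ) (hc : ∀ u v, G.Adj u v →
      ((G.neighborFinset u ∩ G.neighborFinset v).card : ℝ) ≤ c) :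
    (G.adjMatrix ℝ ^ 3).trace ≤ c * (2 * (G.edgeFinset.card : ℝ)) := by
  have h2 : (2 * (G.edgeFinset.card : ℝ)) = ∑ u, ∑ v ∈ G.neighborFinset u, (1:ℝ) := by
    simp only [Finset.sum_const, nsmul_eq_mul, mul_one, SimpleGraph.card_neighborFinset_eq_degree]
    exact_mod_cast G.sum_degrees_eq_twice_card_edges.symm
  rw [h2, Finset.mul_sum, pow_succ', pow_two, Matrix.trace]
  refine Finset.sum_le_sum fun u _ => ?_
  rw [Matrix.diag, SimpleGraph.adjMatrix_mul_apply, Finset.mul_sum]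
  refine Finset.sum_le_sum fun v hv => ?_
  rw [SimpleGraph.adjMatrix_mul_apply]
  rw [SimpleGraph.mem_neighborFinset] at hv
  have := hc u v hv
  simp only [SimpleGraph.adjMatrix_apply, Finset.sum_boole, mul_one]
  refine le_trans ?_ this
  rw [Nat.cast_le]
  apply Finset.card_le_card
  intro w
  simp [SimpleGraph.adj_comm, and_comm]

lemma aux_split {ι : Type*} [Fintype ι] [DecidableEq ι] (μ : ι → ℝ) (F : Finset ι)
    (hF : ∀ i ∈ F, 0 < μ i) :
    (∑ i ∈ F, μ i ^ 2 + ∑ i ∈ Finset.univ.filter (fun i => μ i < 0), |μ i| ^ 2 ≤ ∑ i, μ i ^ 2) ∧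
    (∑ i ∈ F, μ i ^ 3 - ∑ i ∈ Finset.univ.filter (fun i => μ i < 0), |μ i| ^ 3 ≤ ∑ i, μ i ^ 3) := by
  have e : ∀ f : ι → ℝ, ∑ i ∈ F, f i = ∑ i, if i ∈ F then f i else 0 := by
    intro f; simp
  constructor
  · rw [e, Finset.sum_filter, ← Finset.sum_add_distrib]
    refine Finset.sum_le_sum fun i _ => ?_
    have := hF i
    split_ifs with h1 h2 h2
    · linarith [this h1]
    · simp
    · simp
    · simp; positivity
  · rw [e, Finset.sum_filter, ← Finset.sum_sub_distrib]
    refine Finset.sum_le_sum fun i _ => ?_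
    have := hF i
    split_ifs with h1 h2 h2
    · linarith [this h1]
    · simp
    · rw [abs_of_neg h2]; apply le_of_eq; ring
    · simp only [sub_zero]; have := not_lt.1 h2; positivity

lemma aux_negcube {ι : Type*} (x : ι → ℝ) (N : Finset ι) (d : ℝ)
    (hd : ∀ i ∈ N, x i ≤ d) : ∑ i ∈ N, x i ^ 3 ≤ d * ∑ i ∈ N, x i ^ 2 := by
  rw [Finset.mul_sum]
  refine Finset.sum_le_sum fun i hi => ?_
  nlinarith [hd i hi, sq_nonneg (x i)]

lemma aux_poscube {ι : Type*} (x : ι → ℝ) (F : Finset ι) (w c S0 : ℝ) (hF : ∀ i ∈ F, 0 < x i)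
    (hc : 0 < c) (hcard : (F.card : ℝ) ≤ w) (hcw : w * c ^ 2 = S0) (hS : S0 < ∑ i ∈ F, x i ^ 2) :
    c * S0 < ∑ i ∈ F, x i ^ 3 := by
  have h1 : ∑ i ∈ F, (3 / 2 * c * x i ^ 2 - c ^ 3 / 2) ≤ ∑ i ∈ F, x i ^ 3 := by
    refine Finset.sum_le_sum fun i hi => ?_
    have := hF i hi
    nlinarith [mul_nonneg (sq_nonneg (x i - c)) (by positivity : 0 ≤ 2 * x i + c)]
  rw [Finset.sum_sub_distrib, ← Finset.mul_sum, Finset.sum_const, nsmul_eq_mul] at h1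
  have h2 : (F.card : ℝ) * (c ^ 3 / 2) ≤ w * (c ^ 3 / 2) := by gcongr
  have h3 : w * (c ^ 3 / 2) = c * S0 / 2 := by rw [← hcw]; ring
  have h4 := mul_lt_mul_of_pos_left hS hc
  linarith

lemma aux_tf {ι : Type*} [Fintype ι] [DecidableEq ι] (μ : ι → ℝ) (F : Finset ι) (p : ι) (m : ℝ)
    (hp : p ∈ F) (hcard : F.card ≤ 2) (hF : ∀ i ∈ F, 0 < μ i) (hmax : ∀ i, |μ i| ≤ μ p)
    (h2 : ∑ i, μ i ^ 2 = 2 * m) (h3 : ∑ i, μ i ^ 3 ≤ 0) : ∑ i ∈ F, μ i ^ 2 ≤ m := by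
  obtain ⟨b, hb0, hba, hb2, hb3⟩ : ∃ b : ℝ, 0 ≤ b ∧ b ≤ μ p ∧
      ∑ i ∈ F, μ i ^ 2 = μ p ^ 2 + b ^ 2 ∧ ∑ i ∈ F, μ i ^ 3 = μ p ^ 3 + b ^ 3 := by
    rw [← Finset.add_sum_erase _ _ hp, ← Finset.add_sum_erase _ _ hp]
    have : Nonempty ι := ⟨p⟩
    have hc : (F.erase p).card ≤ 1 := by rw [Finset.card_erase_of_mem hp]; omega
    rcases Finset.card_le_one_iff_subset_singleton (s := F.erase p) |>.1 hc with ⟨q, hq⟩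
    rcases Finset.subset_singleton_iff.1 hq with h | h
    · exact ⟨0, le_rfl, (hF p hp).le, by simp [h], by simp [h]⟩
    · have hqF : q ∈ F := Finset.mem_of_mem_erase (h ▸ Finset.mem_singleton_self q)
      exact ⟨μ q, (hF q hqF).le, (le_abs_self _).trans (hmax q), by simp [h], by simp [h]⟩
  obtain ⟨s2, s3⟩ := aux_split μ F hF
  have ha := hF p hp
  set a := μ p with ha_def
  set N := Finset.univ.filter (fun i => μ i < 0) with hN
  by_contra hcon
  push Not at hcon
  rw [hb2] at hcon s2
  rw [hb3] at s3
  have hT : ∑ i ∈ N, |μ i| ^ 2 < a ^ 2 + b ^ 2 := by linarith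
  have hQ : a ^ 3 + b ^ 3 ≤ ∑ i ∈ N, |μ i| ^ 3 := by linarith
  by_cases hall : ∀ i ∈ N, |μ i| ≤ b
  · have h := aux_negcube (fun i => |μ i|) N b hall
    rcases hb0.eq_or_lt with hb | hb
    · subst hb
      have : 0 < a ^ 3 := by positivity
      linarith
    · have h' := mul_lt_mul_of_pos_left hT hb
      have := mul_nonneg (sq_nonneg a) (sub_nonneg.2 hba)
      nlinarith
  · push Not at hall
    obtain ⟨j, hj, hjb⟩ := hall
    have hja := hmax j
    rw [← Finset.add_sum_erase _ _ hj] at hT hQ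
    set x := |μ j| with hxdef
    set R := ∑ i ∈ N.erase j, |μ i| ^ 2 with hR
    have hR0 : 0 ≤ R := Finset.sum_nonneg fun i _ => by positivity
    set y := Real.sqrt (a ^ 2 + b ^ 2 - x ^ 2) with hy
    have hy2 : y ^ 2 = a ^ 2 + b ^ 2 - x ^ 2 := Real.sq_sqrt (by linarith)
    have hy0 : 0 < y := Real.sqrt_pos.2 (by linarith)
    have hyle : ∀ i ∈ N.erase j, |μ i| ≤ y := by
      intro i hi
      apply Real.le_sqrt_of_sq_le
      have := Finset.single_le_sum (f := fun i => |μ i| ^ 2) (fun i _ => by positivity) hi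
      linarith
    have h := aux_negcube (fun i => |μ i|) _ y hyle
    have hyb : b ≤ y := by
      apply Real.le_sqrt_of_sq_le; nlinarith
    have hya : y ≤ a := by
      rw [hy, Real.sqrt_le_iff]; constructor <;> nlinarith
    have hyR : y * R < y * y ^ 2 := by
      apply mul_lt_mul_of_pos_left _ hy0; linarith
    have key : ∀ z, b ≤ z → z ≤ a → z ^ 3 * (a + b) ≤ (a ^ 2 + a * b + b ^ 2) * z ^ 2 - a ^ 2 * b ^ 2 := by
      intro z h1 h2
      have hz : 0 ≤ z := hb0.trans h1
      have := mul_nonneg (mul_nonneg (sub_nonneg.2 h1) (sub_nonneg.2 h2))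
        (by positivity : 0 ≤ z * (a + b) + a * b)
      nlinarith
    have k1 := key x hjb.le hja
    have k2 := key y hyb hya
    have k3 : (x ^ 3 + y ^ 3) * (a + b) ≤ (a ^ 3 + b ^ 3) * (a + b) := by
      have : (a ^ 2 + a * b + b ^ 2) * x ^ 2 + (a ^ 2 + a * b + b ^ 2) * y ^ 2 = (a ^ 2 + a * b + b ^ 2) * (a ^ 2 + b ^ 2) := by rw [hy2]; ring
      nlinarith
    have k4 := le_of_mul_le_mul_right k3 (by positivity)
    nlinarith

lemma aux_num (w k m : ℝ) (hw : 3 ≤ w) (hk : 2 ≤ k) (hwk : w ≤ k + 1)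
    (hm : (10.06 * (k - 1) * Real.sqrt (k + 1) / 3) ^ 2 ≤ m) :
    w * (k - 1) ≤ Real.sqrt (2 * m * (w - 1)) / w * (w - 1) - Real.sqrt (2 * m / w) := by
  have hs : Real.sqrt w ≤ Real.sqrt (k + 1) := Real.sqrt_le_sqrt hwk
  set q := Real.sqrt w with hq
  have hq0 : 0 < q := Real.sqrt_pos.2 (by linarith)
  have hqq : q ^ 2 = w := Real.sq_sqrt (by linarith)
  have hk1 : 0 < k - 1 := by linarith
  have hm0 : 0 ≤ m := le_trans (sq_nonneg _) hm
  have hr : 4.74228 * (k - 1) * q ≤ Real.sqrt (2 * m) := by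
    apply Real.le_sqrt_of_sq_le
    have h1 : (10.06 * (k - 1) * q / 3) ^ 2 ≤ (10.06 * (k - 1) * Real.sqrt (k + 1) / 3) ^ 2 := by
      gcongr
    have h2 : 0 ≤ ((k - 1) * q) ^ 2 := by positivity
    nlinarith
  set r := Real.sqrt (2 * m) with hrdef
  have hr0 : 0 ≤ r := Real.sqrt_nonneg _
  have e1 : Real.sqrt (2 * m / w) = r / q := by
    rw [Real.sqrt_div (by linarith)]
  have e2 : 0.81649 * q * r ≤ Real.sqrt (2 * m * (w - 1)) := by
    apply Real.le_sqrt_of_sq_le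
    have hrr : r ^ 2 = 2 * m := Real.sq_sqrt (by linarith)
    rw [mul_pow, mul_pow, hqq, hrr]
    nlinarith
  rw [e1]
  have e3 : 0.81649 * q * r / w * (w - 1) ≤ Real.sqrt (2 * m * (w - 1)) / w * (w - 1) := by
    have : 0 ≤ w - 1 := by linarith
    have : 0 ≤ w := by linarith
    gcongr
  refine le_trans ?_ (sub_le_sub_right e3 _)
  have e4 : 0.81649 * q * r / w * (w - 1) - r / q = (r * (0.81649 * (w - 1) - 1)) / q := by
    rw [← hqq]; field_simp
  rw [e4, le_div_iff₀ hq0]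
  have e5 : 4.74228 * (k - 1) * q * (0.81649 * (w - 1) - 1) ≤ r * (0.81649 * (w - 1) - 1) := by
    apply mul_le_mul_of_nonneg_right hr; linarith
  refine le_trans ?_ e5
  have : 0 ≤ (k - 1) * q := by positivity
  nlinarith [mul_nonneg this (by linarith : 0 ≤ w - 3)]

/-- **Corollary (book-free graphs).** Let `k ≥ 2` and let `G` be `B_k`-free, i.e. no
pair of adjacent vertices has at least `k` common neighbors. If the number of edges `m`
satisfies `m ≥ (10.06·(k−1)·√(k+1)/3)²`, then `s_ℓ(G) ≤ 2m(1 − 1/ω(G))` where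
`ℓ = min{n⁺, ω(G)}`, `n⁺` is the number of positive eigenvalues, and `s_ℓ` is the sum
of squares of the `ℓ` largest eigenvalues `μ 0 ≥ μ 1 ≥ ⋯`. -/
theorem stmt_7 {V : Type*} [Fintype V] [DecidableEq V]
    (G : SimpleGraph V) [DecidableRel G.Adj]
    (k : ℕ) (hk : 2 ≤ k)
    (hBk : ∀ u v : V, G.Adj u v →
      (G.neighborFinset u ∩ G.neighborFinset v).card < k)
    (m : ℕ) (hm : G.edgeFinset.card = m)
    (hedges : (10.06 * ((k : ℝ) - 1) * Real.sqrt ((k : ℝ) + 1) / 3) ^ 2 ≤ (m : ℝ))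
    (μ : Fin (Fintype.card V) → ℝ) (hanti : Antitone μ)
    (hμ : ∃ e : V ≃ Fin (Fintype.card V),
      ∀ v, (adjMatrix_isHermitian G).eigenvalues v = μ (e v)) :
    (∑ i ∈ Finset.univ.filter
        (fun i : Fin (Fintype.card V) =>
          (i : ℕ) < min ((Finset.univ.filter fun j => 0 < μ j).card) G.cliqueNum),
        μ i ^ 2)
      ≤ 2 * (m : ℝ) * (1 - 1 / (G.cliqueNum : ℝ)) := by
  obtain ⟨e, he⟩ := hμ
  have hpow : ∀ p : ℕ, ∑ i, μ i ^ p = (G.adjMatrix ℝ ^ p).trace := by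
    intro p
    rw [aux_trace_pow (adjMatrix_isHermitian G), ← Equiv.sum_comp e]
    simp [he]
  have hs2 : ∑ i, μ i ^ 2 = 2 * (m : ℝ) := by rw [hpow, aux_sq, hm]
  have hkR : (2 : ℝ) ≤ k := by exact_mod_cast hk
  have hmpos : (0 : ℝ) < m := by
    refine lt_of_lt_of_le ?_ hedges
    have : (0 : ℝ) < (k : ℝ) - 1 := by linarith
    positivity
  -- an edge
  have hw2 : 2 ≤ G.cliqueNum := by
    have : 0 < G.edgeFinset.card := by rw [hm]; exact_mod_cast hmpos
    obtain ⟨d, hd⟩ := Finset.card_pos.1 this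
    rw [SimpleGraph.mem_edgeFinset] at hd
    induction d with | _ u v =>
    rw [SimpleGraph.mem_edgeSet] at hd
    have hc : G.IsClique (({u, v} : Finset V) : Set V) := by
      simp [SimpleGraph.isClique_pair, hd]
    have := SimpleGraph.IsClique.card_le_cliqueNum (tc := hc)
    rwa [Finset.card_pair hd.ne] at this
  have hwk : G.cliqueNum ≤ k + 1 := by
    obtain ⟨s, hs⟩ := G.exists_isNClique_cliqueNum
    obtain ⟨u, hu, v, hv, huv⟩ := Finset.one_lt_card.1 (by rw [hs.card_eq]; omega : 1 < s.card)
    have hadj := hs.isClique hu hv huv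
    have h1 := hBk u v hadj
    have h2 : (s.erase u).erase v ⊆ G.neighborFinset u ∩ G.neighborFinset v := by
      intro x hx
      simp only [Finset.mem_erase] at hx
      simp only [Finset.mem_inter, SimpleGraph.mem_neighborFinset]
      exact ⟨hs.isClique hu hx.2.2 (Ne.symm hx.2.1), hs.isClique hv hx.2.2 (Ne.symm hx.1)⟩
    have h3 := Finset.card_le_card h2
    rw [Finset.card_erase_of_mem (Finset.mem_erase.2 ⟨huv.symm, hv⟩), Finset.card_erase_of_mem hu,
      hs.card_eq] at h3
    omega
  set w := G.cliqueNum with hw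
  set np := (Finset.univ.filter fun j => 0 < μ j).card with hn
  set F := Finset.univ.filter
        (fun i : Fin (Fintype.card V) => (i : ℕ) < min np w) with hFdef
  have hFpos : ∀ i ∈ F, 0 < μ i := by
    intro i hi
    by_contra hcon
    have h1 : (Finset.univ.filter fun j => 0 < μ j) ⊆ Finset.Iio i := by
      intro j hj
      rw [Finset.mem_filter] at hj
      rw [Finset.mem_Iio]
      by_contra hji
      exact hcon (hj.2.trans_le (hanti (not_lt.1 hji)))
    have h2 := Finset.card_le_card h1
    rw [Fin.card_Iio] at h2
    have h3 := (Finset.mem_filter.1 hi).2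
    omega
  have hFcard : F.card ≤ w := by
    have h1 : F.card = (F.map Fin.valEmbedding).card := (Finset.card_map _).symm
    have h2 : F.map Fin.valEmbedding ⊆ Finset.range w := by
      intro x hx
      rw [Finset.mem_map] at hx
      obtain ⟨i, hi, rfl⟩ := hx
      have := (Finset.mem_filter.1 hi).2
      simp only [Finset.mem_range, Fin.valEmbedding_apply]
      omega
    have h3 := Finset.card_le_card h2
    rw [Finset.card_range] at h3
    omega
  rcases hw2.eq_or_lt with hw2 | hw3
  · -- triangle-free case
    have hs3 : ∑ i, μ i ^ 3 ≤ 0 := by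
      rw [hpow]
      refine (aux_cube G 0 ?_).trans (by simp)
      intro u v huv
      have : G.neighborFinset u ∩ G.neighborFinset v = ∅ := by
        by_contra hne
        obtain ⟨x, hx⟩ := Finset.nonempty_iff_ne_empty.2 hne
        simp only [Finset.mem_inter, SimpleGraph.mem_neighborFinset] at hx
        have hc : G.IsNClique 3 {u, v, x} := by
          rw [SimpleGraph.is3Clique_triple_iff]
          exact ⟨huv, hx.1, hx.2⟩
        have := SimpleGraph.IsClique.card_le_cliqueNum (tc := hc.isClique)
        rw [hc.card_eq] at this
        omega
      simp [this]
    have hgoal : 2 * (m : ℝ) * (1 - 1 / (w : ℝ)) = m := by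
      rw [← hw2]; push_cast; ring
    rw [hgoal]
    rcases F.eq_empty_or_nonempty with hE | ⟨i, hi⟩
    · rw [hE]; simpa using hmpos.le
    · have hpos : 0 < Fintype.card V := i.pos
      have hp : (⟨0, hpos⟩ : Fin (Fintype.card V)) ∈ F := by
        have := (Finset.mem_filter.1 hi).2
        rw [hFdef, Finset.mem_filter]
        refine ⟨Finset.mem_univ _, ?_⟩
        show 0 < _
        omega
      refine aux_tf μ F ⟨0, hpos⟩ m hp (by omega) hFpos ?_ hs2 hs3
      intro i
      have := aux_perron (adjMatrix_isHermitian G) ?_ (μ ⟨0, hpos⟩) ?_ (e.symm i)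
      · simpa [he] using this
      · intro u v
        rw [SimpleGraph.adjMatrix_apply]
        split_ifs <;> norm_num
      · intro v
        rw [he]
        exact hanti (Nat.zero_le _)
  · have hs3 : ∑ i, μ i ^ 3 ≤ ((k : ℝ) - 1) * (2 * m) := by
      rw [hpow, ← hm]
      apply aux_cube
      intro u v huv
      have h1 : (G.neighborFinset u ∩ G.neighborFinset v).card + 1 ≤ k := hBk u v huv
      have : (((G.neighborFinset u ∩ G.neighborFinset v).card + 1 : ℕ) : ℝ) ≤ k := by
        exact_mod_cast h1
      push_cast at this
      linarith
    have hwR : (3 : ℝ) ≤ w := by exact_mod_cast hw3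
    have hnum := aux_num w k m hwR hkR (by exact_mod_cast hwk) hedges
    by_contra hcon
    push Not at hcon
    obtain ⟨s2, s3⟩ := aux_split μ F hFpos
    have hw0 : (0 : ℝ) < w := by linarith
    set c := Real.sqrt (2 * m * (w - 1)) / w with hc
    set d := Real.sqrt (2 * m / w) with hd
    have hc0 : 0 < c := by
      have : (0 : ℝ) < w - 1 := by linarith
      positivity
    have hc2 : (w : ℝ) * c ^ 2 = 2 * (m : ℝ) * (1 - 1 / (w : ℝ)) := by
      have : (0 : ℝ) ≤ w - 1 := by linarith
      rw [hc, div_pow, Real.sq_sqrt (by positivity)]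
      field_simp
    have hP := aux_poscube μ F w c _ hFpos hc0 (by exact_mod_cast hFcard) hc2 hcon
    set N := Finset.univ.filter (fun i => μ i < 0) with hN
    have hT : ∑ i ∈ N, |μ i| ^ 2 ≤ 2 * m / w := by
      have : 2 * (m : ℝ) * (1 - 1 / (w : ℝ)) = 2 * m - 2 * m / w := by ring
      linarith
    have hQ := aux_negcube (fun i => |μ i|) N d (by
      intro i hi
      apply Real.le_sqrt_of_sq_le
      have := Finset.single_le_sum (f := fun i => |μ i| ^ 2) (fun i _ => by positivity) hi
      linarith)
    have hd0 : 0 ≤ d := Real.sqrt_nonneg _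
    have hQ2 : d * ∑ i ∈ N, |μ i| ^ 2 ≤ d * (2 * m / w) := mul_le_mul_of_nonneg_left hT hd0
    have hfin : c * (2 * (m : ℝ) * (1 - 1 / (w : ℝ))) - d * (2 * m / w) < ((k : ℝ) - 1) * (2 * m) := by
      linarith
    have h1 : c * (2 * (m : ℝ) * (1 - 1 / (w : ℝ))) - d * (2 * m / w)
        = (2 * m / w) * (c * (w - 1) - d) := by
      field_simp
    have h2 : ((k : ℝ) - 1) * (2 * m) = (2 * m / w) * (w * (k - 1)) := by
      field_simp
    rw [h1, h2] at hfin
    exact absurd (lt_of_mul_lt_mul_left hfin (by positivity)) (not_lt.2 hnum)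
end
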